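/- arXiv:1001.2792 — 2 statements merged into one kernel-verified Lean document; each statement's English description precedes it below -/
import Mathlib

section
/- Let P ⊂ ℝ^n be an n-dimensional lattice simplex with vertices v_0, …, v_n. Then c(P) = Σ_{I ⊆ {0,…,n}} C(|I|, n) · s_I, where C(·,·) is the binomial coefficient (so only subsets I with |I| ≥ n contribute). -/
open scoped Pointwise
open MeasureTheory

noncomputable section

/-- The image of an integer point under the coercion `ℤ → ℝ` (a lattice point). -/
def latt {ι : Type*} (x : ι → ℤ) : ι → ℝ := fun i => (x i : ℝ)

/-- `F` is a (nonempty, exposed) face of `P` of dimension `j`. -/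
def IsFaceOfDim {n : ℕ} (P F : Set (Fin n → ℝ)) (j : ℕ) : Prop :=
  F.Nonempty ∧ IsExposed ℝ P F ∧ Module.finrank ℝ (affineSpan ℝ F).direction = j

/-- `φ : ℝ^j → ℝ^n` is an affine parametrization of the affine hull of `F` mapping the
lattice `ℤ^j` bijectively onto `aff(F) ∩ ℤ^n`.  Pulling `F` back by such a `φ` computes
volumes with respect to the lattice `aff(F) ∩ ℤ^n`. -/
def IsUnimodularParam {n j : ℕ} (F : Set (Fin n → ℝ))
    (φ : (Fin j → ℝ) →ᵃ[ℝ] (Fin n → ℝ)) : Prop :=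
  Function.Injective φ ∧
    Set.range φ = (affineSpan ℝ F : Set (Fin n → ℝ)) ∧
    ∀ x : Fin j → ℝ, (∃ w : Fin j → ℤ, x = latt w) ↔ ∃ z : Fin n → ℤ, φ x = latt z

/-- The lifted vertex `(v_i, 1) ∈ ℝ^n × ℝ = ℝ^{n+1}`. -/
def vhat {n : ℕ} (v : Fin (n + 1) → Fin n → ℤ) (i : Fin (n + 1)) : Fin (n + 1) → ℝ :=
  Fin.snoc (latt (v i)) 1

/-- For `I ⊆ {0, …, n}`, the number `s_I` of points `x ∈ ℤ^{n+1}` of the form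
`x = ∑_{i ∈ I} λ_i (v_i, 1)` with `0 < λ_i < 1` for all `i ∈ I`.
(For `I = ∅` this set is `{0}`, so `s_∅ = 1`.) -/
def sI {n : ℕ} (v : Fin (n + 1) → Fin n → ℤ) (I : Finset (Fin (n + 1))) : ℕ :=
  Set.ncard {x : Fin (n + 1) → ℤ | ∃ lam : Fin (n + 1) → ℝ,
    (∀ i ∈ I, 0 < lam i ∧ lam i < 1) ∧ latt x = ∑ i ∈ I, lam i • vhat v i}

/-- The volume of the corner simplex `{x ≥ 0, ∑ x ≤ r}` is `r ^ n / n!`. -/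
lemma volume_corner_simplex (n : ℕ) (r : ℝ) (hr : 0 ≤ r) :
    volume {x : Fin n → ℝ | (∀ i, 0 ≤ x i) ∧ ∑ i, x i ≤ r} =
      ENNReal.ofReal (r ^ n / n.factorial) := by
  induction n generalizing r with
  | zero => simp [hr, volume_pi, Measure.pi_of_empty (β := fun _ => ℝ)]
  | succ n ih =>
    have hmp := volume_preserving_piFinSuccAbove (fun _ : Fin (n + 1) => ℝ) 0
    set s : Set (ℝ × (Fin n → ℝ)) := {p | 0 ≤ p.1 ∧ (∀ i, 0 ≤ p.2 i) ∧ p.1 + ∑ i, p.2 i ≤ r}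
    have hs : MeasurableSet s := by
      have : s = {p | 0 ≤ p.1} ∩ ((⋂ i, {p | 0 ≤ p.2 i}) ∩ {p | p.1 + ∑ i, p.2 i ≤ r}) := by
        ext; simp [s]
      rw [this]
      exact ((isClosed_le (by fun_prop) (by fun_prop)).inter
        ((isClosed_iInter fun i => isClosed_le (by fun_prop) (by fun_prop)).inter
          (isClosed_le (by fun_prop) (by fun_prop)))).measurableSet
    have hpre : {x : Fin (n + 1) → ℝ | (∀ i, 0 ≤ x i) ∧ ∑ i, x i ≤ r} =
        (MeasurableEquiv.piFinSuccAbove (fun _ : Fin (n + 1) => ℝ) 0) ⁻¹' s := by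
      ext x
      simp [s, Fin.forall_fin_succ, Fin.sum_univ_succ, Fin.tail, Fin.insertNthEquiv, and_assoc]
    rw [hpre, hmp.measure_preimage hs.nullMeasurableSet, Measure.volume_eq_prod,
      Measure.prod_apply hs]
    have hsec : ∀ x : ℝ, volume (Prod.mk x ⁻¹' s) =
        (Set.Icc 0 r).indicator (fun x => ENNReal.ofReal ((r - x) ^ n / n.factorial)) x := by
      intro x
      by_cases hx : x ∈ Set.Icc 0 r
      · rw [Set.indicator_of_mem hx, ← ih (r - x) (by linarith [hx.2])]
        congr 1
        ext y
        simp only [s, Set.mem_preimage, Set.mem_ofPred_eq, hx.1, true_and]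
        constructor <;> rintro ⟨h1, h2⟩ <;> exact ⟨h1, by linarith⟩
      · rw [Set.indicator_of_notMem hx]
        rw [← measure_empty (μ := (volume : Measure (Fin n → ℝ)))]
        congr 1
        ext y
        simp only [s, Set.mem_preimage, Set.mem_ofPred_eq, Set.mem_empty_iff_false, iff_false]
        rintro ⟨h0, h1, h2⟩
        exact hx ⟨h0, by linarith [Finset.sum_nonneg (s := Finset.univ) fun i _ => h1 i]⟩
    simp_rw [hsec]
    rw [lintegral_indicator measurableSet_Icc, ← ofReal_integral_eq_lintegral_ofReal]
    · congr 1
      rw [integral_Icc_eq_integral_Ioc, ← intervalIntegral.integral_of_le hr,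
        intervalIntegral.integral_div,
        intervalIntegral.integral_comp_sub_left (fun x => x ^ n) r, integral_pow]
      simp [Nat.factorial_succ]
      field_simp
    · exact (Continuous.integrableOn_Icc (by fun_prop))
    · refine (ae_restrict_iff' measurableSet_Icc).2 (Filter.Eventually.of_forall fun x hx => ?_)
      have : 0 ≤ r - x := by linarith [hx.2]
      positivity

/-- The volume of the simplex spanned by the origin and a basis. -/
lemma volume_convexHull_insert_zero_basis {j : ℕ} (e : Module.Basis (Fin j) ℝ (Fin j → ℝ)) :
    volume (convexHull ℝ (insert 0 (Set.range e))) =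
      ENNReal.ofReal (|(Matrix.of e).det| / j.factorial) := by
  have himg : convexHull ℝ (insert 0 (Set.range e)) =
      (e.equivFun.symm : (Fin j → ℝ) →ₗ[ℝ] (Fin j → ℝ)) ''
        {x : Fin j → ℝ | (∀ i, 0 ≤ x i) ∧ ∑ i, x i ≤ 1} := by
    apply Set.Subset.antisymm
    · refine convexHull_min ?_ ?_
      · rintro y (rfl | ⟨k, rfl⟩)
        · exact ⟨0, by simp, by simp⟩
        · refine ⟨Pi.single k 1, ⟨fun i => ?_, by simp⟩, by simp [Module.Basis.equivFun_symm_apply, Pi.single_apply]⟩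
          by_cases h : i = k <;> simp [h]
      · refine Convex.linear_image ?_ _
        intro x hx y hy a b ha hb hab
        refine ⟨fun i => ?_, ?_⟩
        · have := hx.1 i; have := hy.1 i
          simp only [Pi.add_apply, Pi.smul_apply, smul_eq_mul]; positivity
        · simp only [Pi.add_apply, Pi.smul_apply, smul_eq_mul, Finset.sum_add_distrib,
            ← Finset.mul_sum]
          nlinarith [hx.2, hy.2]
    · rintro _ ⟨x, ⟨h0, h1⟩, rfl⟩
      have key := (convex_convexHull ℝ (insert 0 (Set.range e))).sum_mem
        (t := (Finset.univ : Finset (Option (Fin j))))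
        (w := fun o => o.elim (1 - ∑ i, x i) x) (z := fun o => o.elim 0 e)
        (by rintro (_ | i) _ <;> simp [h0, h1]) (by simp [Fintype.sum_option])
        (by rintro (_ | i) _ <;> apply subset_convexHull <;> simp)
      simpa [Fintype.sum_option, Module.Basis.equivFun_symm_apply] using key
  rw [himg, Measure.addHaar_image_linearMap, volume_corner_simplex j 1 zero_le_one,
    ← ENNReal.ofReal_mul (abs_nonneg _)]
  congr 1
  have : LinearMap.det (e.equivFun.symm : (Fin j → ℝ) →ₗ[ℝ] (Fin j → ℝ)) = (Matrix.of e).det := by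
    rw [← LinearMap.det_toMatrix', ← Matrix.det_transpose]
    congr 1
    ext a b
    rw [Matrix.transpose_apply, LinearMap.toMatrix'_apply, LinearEquiv.coe_coe, Module.Basis.equivFun_symm_apply,
      Finset.sum_eq_single a] <;> simp +contextual
  rw [this]; simp [div_eq_mul_inv]

lemma latt_injective {ι : Type*} : Function.Injective (latt : (ι → ℤ) → ι → ℝ) :=
  fun x y h => funext fun i => by simpa [latt] using congrFun h i

lemma mem_span_int_basisFun_iff {ι : Type*} [Finite ι] (x : ι → ℝ) :
    x ∈ Submodule.span ℤ (Set.range (Pi.basisFun ℝ ι)) ↔ ∃ z : ι → ℤ, x = latt z := by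
  rw [Module.Basis.mem_span_iff_repr_mem]
  simp only [Pi.basisFun_repr, Set.mem_range]
  constructor
  · intro h
    choose z hz using h
    exact ⟨z, funext fun i => by simp [latt, ← hz]⟩
  · rintro ⟨z, rfl⟩ i
    exact ⟨z i, by simp [latt]⟩

/-- The number of lattice points in the fundamental domain of an integral basis is the absolute
value of the determinant of the basis. -/
lemma ncard_latt_mem_fundamentalDomain {j : ℕ} (e : Module.Basis (Fin j) ℝ (Fin j → ℝ))
    (he : ∀ k, ∃ z : Fin j → ℤ, e k = latt z) :
    ({z : Fin j → ℤ | latt z ∈ ZSpan.fundamentalDomain e}.ncard : ℝ) = |(Matrix.of e).det| := by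
  set L₁ := Submodule.span ℤ (Set.range e) with hL₁
  set L₂ := Submodule.span ℤ (Set.range (Pi.basisFun ℝ (Fin j))) with hL₂
  have hle : L₁ ≤ L₂ := by
    rw [hL₁, Submodule.span_le]
    rintro _ ⟨k, rfl⟩
    exact (mem_span_int_basisFun_iff _).2 (he k)
  have h := ZLattice.covolume_div_covolume_eq_relIndex L₁ L₂ hle
  rw [ZLattice.covolume_eq_measure_fundamentalDomain L₁ volume (ZSpan.isAddFundamentalDomain e _),
    ZLattice.covolume_eq_measure_fundamentalDomain L₂ volume (ZSpan.isAddFundamentalDomain _ _),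
    ZSpan.volume_real_fundamentalDomain, ZSpan.volume_real_fundamentalDomain] at h
  have h1 : (Matrix.of (Pi.basisFun ℝ (Fin j))).det = 1 := by
    rw [← Matrix.det_one (n := Fin j) (R := ℝ)]
    congr 1
    ext a b
    simp [Matrix.one_apply, Pi.single_apply, eq_comm]
  rw [h1, abs_one, div_one] at h
  rw [h, Nat.cast_inj, AddSubgroup.relIndex, AddSubgroup.index, ← Nat.card_coe_set_eq]
  refine Nat.card_eq_of_bijective (fun z => QuotientAddGroup.mk
    (⟨latt z.1, (mem_span_int_basisFun_iff _).2 ⟨z.1, rfl⟩⟩ : L₂.toAddSubgroup)) ⟨?_, ?_⟩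
  · rintro ⟨z, hz⟩ ⟨w, hw⟩ hzw
    have h2 := (ZSpan.fract_eq_fract e (latt z) (latt w)).2
      (by simpa [QuotientAddGroup.eq, AddSubgroup.mem_addSubgroupOf] using hzw)
    rw [ZSpan.fract_eq_self.2 hz, ZSpan.fract_eq_self.2 hw] at h2
    exact Subtype.ext (latt_injective h2)
  · intro q
    obtain ⟨⟨y, hy⟩, rfl⟩ := QuotientAddGroup.mk_surjective q
    have hf : ZSpan.fract e y ∈ L₂ := by
      rw [ZSpan.fract_apply]
      exact sub_mem hy (hle (SetLike.coe_mem _))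
    obtain ⟨z, hz⟩ := (mem_span_int_basisFun_iff _).1 hf
    refine ⟨⟨z, by
      rw [Set.mem_ofPred_eq, ← hz]; exact ZSpan.fract_mem_fundamentalDomain e y⟩, ?_⟩
    rw [QuotientAddGroup.eq, AddSubgroup.mem_addSubgroupOf]
    have : -(latt z) + y = (ZSpan.floor e y : Fin j → ℝ) := by
      rw [← hz, ZSpan.fract_apply]; abel
    simp only [AddSubgroup.coe_add, AddSubgroup.coe_neg, this]
    exact SetLike.coe_mem (ZSpan.floor e y)

/-- The affine hull of a lattice simplex has a unimodular parametrization based at a vertex. -/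
lemma exists_isUnimodularParam {n j : ℕ} (u : Fin (j + 1) → Fin n → ℤ)
    (hu : AffineIndependent ℝ fun i => latt (u i)) :
    ∃ φ : (Fin j → ℝ) →ᵃ[ℝ] (Fin n → ℝ),
      IsUnimodularParam (convexHull ℝ (Set.range fun i => latt (u i))) φ ∧ φ 0 = latt (u 0) := by
  set W := (affineSpan ℝ (Set.range fun i => latt (u i))).direction with hW
  have hWspan : W = Submodule.span ℝ (Set.range fun i => latt (u i) - latt (u 0)) := by
    rw [hW, direction_affineSpan, vectorSpan_eq_span_vsub_set_right ℝ (Set.mem_range_self 0),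
      ← Set.range_comp]
    rfl
  set L : Submodule ℤ W := ZLattice.comap ℝ
    (Submodule.span ℤ (Set.range (Pi.basisFun ℝ (Fin n)))) W.subtype with hL
  have hLmem (x : W) : x ∈ L ↔ ∃ z : Fin n → ℤ, (x : Fin n → ℝ) = latt z :=
    mem_span_int_basisFun_iff _
  have : DiscreteTopology L := ZLattice.comap_discreteTopology _ _
    W.subtype.continuous_of_finiteDimensional W.subtype_injective
  have : IsZLattice ℝ L := by
    constructor
    rw [← Submodule.map_injective_of_injective W.subtype_injective |>.eq_iff, Submodule.map_span,
      Submodule.map_top, Submodule.range_subtype]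
    apply le_antisymm
    · rw [Submodule.span_le]
      rintro _ ⟨x, -, rfl⟩
      exact x.2
    · conv_lhs => rw [hWspan]
      apply Submodule.span_mono
      rintro _ ⟨i, rfl⟩
      refine ⟨⟨latt (u i) - latt (u 0), hWspan ▸ Submodule.subset_span ⟨i, rfl⟩⟩, ?_, rfl⟩
      exact (hLmem _).2 ⟨u i - u 0, by ext; simp [latt]⟩
  have hfin : Module.finrank ℝ W = j := by
    rw [hW, direction_affineSpan]
    exact hu.finrank_vectorSpan (by simp)
  have : Module.Finite ℤ L := ZLattice.module_finite ℝ L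
  have : Module.Free ℤ L := ZLattice.module_free ℝ L
  let b : Module.Basis (Fin j) ℤ L :=
    Module.finBasisOfFinrankEq ℤ L (by rw [ZLattice.rank ℝ L, hfin])
  let c : Module.Basis (Fin j) ℝ W := b.ofZLatticeBasis ℝ L
  let f : (Fin j → ℝ) →ₗ[ℝ] (Fin n → ℝ) := W.subtype ∘ₗ c.equivFun.symm
  have hf : Function.Injective f := W.subtype_injective.comp c.equivFun.symm.injective
  have hfr : LinearMap.range f = W := by
    simp [f, LinearMap.range_comp]
  let φ : (Fin j → ℝ) →ᵃ[ℝ] (Fin n → ℝ) :=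
    f.toAffineMap + AffineMap.const ℝ _ (latt (u 0))
  have hφ (x) : φ x = f x + latt (u 0) := rfl
  refine ⟨φ, ⟨?_, ?_, ?_⟩, by simp [hφ]⟩
  · intro x y hxy
    exact hf (by simpa [hφ] using hxy)
  · have h0 : latt (u 0) ∈ affineSpan ℝ (Set.range fun i => latt (u i)) :=
      subset_affineSpan _ _ ⟨0, rfl⟩
    rw [affineSpan_convexHull]
    ext y
    rw [SetLike.mem_coe, ← AffineSubspace.vsub_right_mem_direction_iff_mem h0, ← hW, ← hfr]
    simp only [Set.mem_range, LinearMap.mem_range, hφ, vsub_eq_sub, eq_sub_iff_add_eq]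
  · intro x
    have h1 : (∃ z : Fin n → ℤ, φ x = latt z) ↔ c.equivFun.symm x ∈ L := by
      rw [hLmem]
      constructor
      · rintro ⟨z, hz⟩
        refine ⟨z - u 0, ?_⟩
        have : f x = latt z - latt (u 0) := by rw [← hz, hφ]; simp
        exact this.trans (by ext; simp [latt])
      · rintro ⟨z, hz⟩
        refine ⟨z + u 0, ?_⟩
        have : f x = latt z := hz
        rw [hφ, this]; ext; simp [latt]
    rw [h1, ← mem_span_int_basisFun_iff, Module.Basis.mem_span_iff_repr_mem]
    conv_rhs => rw [← b.ofZLatticeBasis_span ℝ, Module.Basis.mem_span_iff_repr_mem]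
    have h2 (i) : c.repr (c.equivFun.symm x) i = x i :=
      congrFun (c.equivFun.apply_symm_apply x) i
    change _ ↔ ∀ i, c.repr (c.equivFun.symm x) i ∈ _
    simp only [h2]
    simp

lemma latt_snoc_eq_sum_iff {ι : Type*} {n : ℕ} (s : Finset ι) (u : ι → Fin n → ℤ)
    (a : Fin n → ℤ) (t : ℤ) (lam : ι → ℝ) :
    latt (Fin.snoc a t : Fin (n + 1) → ℤ) =
        ∑ i ∈ s, lam i • (Fin.snoc (latt (u i)) 1 : Fin (n + 1) → ℝ) ↔
      latt a = ∑ i ∈ s, lam i • latt (u i) ∧ (t : ℝ) = ∑ i ∈ s, lam i := by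
  constructor
  · intro h
    refine ⟨funext fun i => ?_, ?_⟩
    · simpa [latt, Finset.sum_apply] using congrFun h i.castSucc
    · simpa [latt, Finset.sum_apply] using congrFun h (Fin.last n)
  · rintro ⟨h1, h2⟩
    funext i
    refine Fin.lastCases ?_ (fun i => ?_) i
    · simpa [latt, Finset.sum_apply] using h2
    · simpa [latt, Finset.sum_apply] using congrFun h1 i

/-- The normalized volume of a lattice simplex is the number of lattice points of the half-open
parallelepiped over it, and it is positive. -/
lemma factorial_mul_volume_eq_ncard {n j : ℕ} (u : Fin (j + 1) → Fin n → ℤ)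
    (hu : AffineIndependent ℝ fun i => latt (u i)) (φ : (Fin j → ℝ) →ᵃ[ℝ] (Fin n → ℝ))
    (hφ : IsUnimodularParam (convexHull ℝ (Set.range fun i => latt (u i))) φ)
    (h0 : φ 0 = latt (u 0)) :
    (j.factorial : ℝ) *
        (volume (φ ⁻¹' convexHull ℝ (Set.range fun i => latt (u i)))).toReal =
      ({x : Fin (n + 1) → ℤ | ∃ lam : Fin (j + 1) → ℝ, (∀ i, 0 ≤ lam i ∧ lam i < 1) ∧
        latt x = ∑ i, lam i • (Fin.snoc (latt (u i)) 1 : Fin (n + 1) → ℝ)}.ncard : ℝ) ∧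
    0 < {x : Fin (n + 1) → ℤ | ∃ lam : Fin (j + 1) → ℝ, (∀ i, 0 ≤ lam i ∧ lam i < 1) ∧
        latt x = ∑ i, lam i • (Fin.snoc (latt (u i)) 1 : Fin (n + 1) → ℝ)}.ncard := by
  obtain ⟨hinj, hrange, hlat⟩ := hφ
  have hw : ∀ i, ∃ w : Fin j → ℤ, φ (latt w) = latt (u i) := by
    intro i
    have hi : latt (u i) ∈ Set.range φ := by
      rw [hrange]
      exact subset_affineSpan _ _ (subset_convexHull _ _ ⟨i, rfl⟩)
    obtain ⟨x, hx⟩ := hi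
    obtain ⟨w, rfl⟩ := (hlat x).2 ⟨u i, hx⟩
    exact ⟨w, hx⟩
  choose w hw using hw
  have hw0 : latt (w 0) = 0 := hinj (by rw [hw, h0])
  have hwi : AffineIndependent ℝ fun i => latt (w i) := by
    refine AffineIndependent.of_comp φ ?_
    convert hu using 2 with i
    exact hw i
  have hli : LinearIndependent ℝ fun k : Fin j => latt (w k.succ) := by
    have := (affineIndependent_iff_linearIndependent_vsub ℝ _ 0).1 hwi
    have := this.comp (fun k : Fin j => (⟨k.succ, Fin.succ_ne_zero k⟩ : {x : Fin (j + 1) // x ≠ 0}))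
      (fun a b hab => by simpa using hab)
    simpa [Function.comp_def, hw0] using this
  let e := basisOfLinearIndependentOfCardEqFinrank' _ hli (by simp)
  have he (k) : e k = latt (w k.succ) := by simp [e]
  have hφlin (x) : φ x = φ.linear x + latt (u 0) := by
    simpa [h0] using φ.map_vadd 0 x
  have hφe (k) : φ.linear (e k) = latt (u k.succ) - latt (u 0) := by
    rw [eq_sub_iff_add_eq, ← hφlin, he, hw]
  have hpre : φ ⁻¹' convexHull ℝ (Set.range fun i => latt (u i)) =
      convexHull ℝ (insert 0 (Set.range e)) := by
    have : Set.range (fun i => latt (u i)) = φ '' (insert 0 (Set.range e)) := by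
      ext y
      simp [Fin.exists_fin_succ, h0, he, hw, eq_comm]
    rw [this, ← AffineMap.image_convexHull, Set.preimage_image_eq _ hinj]
  have hdet : (Matrix.of e).det ≠ 0 := by
    intro h
    have h2 := ZSpan.volume_real_fundamentalDomain e
    rw [h, abs_zero, Measure.real, ENNReal.toReal_eq_zero_iff] at h2
    rcases h2 with h2 | h2
    · exact ZSpan.measure_fundamentalDomain_ne_zero e h2
    · exact (ZSpan.fundamentalDomain_isBounded e).measure_lt_top.ne h2
  have hy : ∀ z : Fin j → ℤ, ∃ y : Fin n → ℤ, φ (latt z) = latt y :=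
    fun z => (hlat _).1 ⟨z, rfl⟩
  choose y hy using hy
  have hsum (μ : Fin j → ℝ) : φ.linear (∑ k, μ k • e k) =
      ∑ k, μ k • latt (u k.succ) - (∑ k, μ k) • latt (u 0) := by
    simp [hφe, smul_sub, Finset.sum_sub_distrib, Finset.sum_smul]
  have hcount := ncard_latt_mem_fundamentalDomain e (fun k => ⟨_, he k⟩)
  have hncard : {z : Fin j → ℤ | latt z ∈ ZSpan.fundamentalDomain e}.ncard =
      {x : Fin (n + 1) → ℤ | ∃ lam : Fin (j + 1) → ℝ, (∀ i, 0 ≤ lam i ∧ lam i < 1) ∧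
        latt x = ∑ i, lam i • (Fin.snoc (latt (u i)) 1 : Fin (n + 1) → ℝ)}.ncard := by
    refine Set.ncard_congr (fun z _ => Fin.snoc
      (y z + (⌈∑ k, e.repr (latt z) k⌉ - 1) • u 0) ⌈∑ k, e.repr (latt z) k⌉) ?_ ?_ ?_
    · intro z hz
      set t := ⌈∑ k, e.repr (latt z) k⌉ with ht
      refine ⟨Fin.cons (t - ∑ k, e.repr (latt z) k) (e.repr (latt z)), ?_, ?_⟩
      · rw [Fin.forall_fin_succ]
        refine ⟨?_, fun k => by simpa using hz k⟩
        have h1 := Int.le_ceil (∑ k, e.repr (latt z) k)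
        have h2 := Int.ceil_lt_add_one (∑ k, e.repr (latt z) k)
        rw [← ht] at h1 h2
        simp only [Fin.cons_zero]
        constructor <;> linarith
      · rw [latt_snoc_eq_sum_iff]
        refine ⟨?_, by simp [Fin.sum_univ_succ]⟩
        have h1 : latt (y z) = (∑ k, e.repr (latt z) k • latt (u k.succ) -
            (∑ k, e.repr (latt z) k) • latt (u 0)) + latt (u 0) := by
          rw [← hsum, e.sum_repr, ← hφlin, hy]
        have h2 : latt (y z + (t - 1) • u 0) = latt (y z) + ((t : ℝ) - 1) • latt (u 0) := by
          ext i; simp [latt]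
        rw [h2, h1, Fin.sum_univ_succ]
        simp only [Fin.cons_zero, Fin.cons_succ]
        module
    · intro a b _ _ hab
      have h1 := (Fin.snoc_injective2 hab).2
      have h2 := (Fin.snoc_injective2 hab).1
      rw [h1, add_left_inj] at h2
      exact latt_injective (hinj (by rw [hy, hy, h2]))
    · rintro x ⟨lam, hlam, hx⟩
      rw [← Fin.snoc_init_self x, latt_snoc_eq_sum_iff, Fin.sum_univ_succ, Fin.sum_univ_succ] at hx
      obtain ⟨hx1, hx2⟩ := hx
      set t := x (Fin.last n) with ht
      have h1 : φ (∑ k : Fin j, lam k.succ • e k) = latt (Fin.init x - (t - 1) • u 0) := by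
        have : latt (Fin.init x - (t - 1) • u 0) =
            latt (Fin.init x : Fin n → ℤ) - ((t : ℝ) - 1) • latt (u 0) := by
          ext i; simp [latt]
        rw [this, hx1, hx2, hφlin, hsum]
        module
      obtain ⟨z, hz⟩ := (hlat _).2 ⟨_, h1⟩
      have hrepr (k) : e.repr (latt z) k = lam k.succ := by
        rw [← hz, ← e.equivFun_apply]
        simpa [Module.Basis.equivFun_symm_apply] using
          congrFun (e.equivFun.apply_symm_apply fun k => lam k.succ) k
      have hceil : ⌈∑ k, e.repr (latt z) k⌉ = t := by
        rw [Int.ceil_eq_iff]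
        simp only [hrepr]
        have := hlam 0
        constructor <;> linarith
      have hyz : y z = Fin.init x - (t - 1) • u 0 :=
        latt_injective (by rw [← hy, ← hz, h1])
      refine ⟨z, fun k => by rw [hrepr]; exact hlam _, ?_⟩
      rw [hceil, hyz, sub_add_cancel, ht, Fin.snoc_init_self]
  rw [← hncard]
  constructor
  · rw [hcount, hpre, volume_convexHull_insert_zero_basis,
      ENNReal.toReal_ofReal (by positivity)]
    field_simp
  · have : (0 : ℝ) < |(Matrix.of e).det| := abs_pos.2 hdet
    rw [← hcount] at this
    exact_mod_cast this

lemma linearIndependent_vhat {n : ℕ} (v : Fin (n + 1) → Fin n → ℤ)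
    (hv : AffineIndependent ℝ fun i => latt (v i)) : LinearIndependent ℝ (vhat v) := by
  rw [linearIndependent_iff']
  intro s g hg
  refine affineIndependent_iff.1 hv s g ?_ ?_
  · simpa [vhat, Finset.sum_apply] using congrFun hg (Fin.last n)
  · funext i
    simpa [vhat, Finset.sum_apply] using congrFun hg i.castSucc

/-- The half-open parallelepiped is partitioned according to the support of the coordinates. -/
lemma sum_powerset_sI {n : ℕ} (v : Fin (n + 1) → Fin n → ℤ)
    (hv : AffineIndependent ℝ fun i => latt (v i)) (J : Finset (Fin (n + 1)))
    (hfin : {x : Fin (n + 1) → ℤ | ∃ lam : Fin (n + 1) → ℝ, (∀ i ∈ J, 0 ≤ lam i ∧ lam i < 1) ∧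
      latt x = ∑ i ∈ J, lam i • vhat v i}.Finite) :
    {x : Fin (n + 1) → ℤ | ∃ lam : Fin (n + 1) → ℝ, (∀ i ∈ J, 0 ≤ lam i ∧ lam i < 1) ∧
      latt x = ∑ i ∈ J, lam i • vhat v i}.ncard = ∑ I ∈ J.powerset, sI v I := by
  set S : Finset (Fin (n + 1)) → Set (Fin (n + 1) → ℤ) := fun I =>
    {x | ∃ lam : Fin (n + 1) → ℝ,
      (∀ i ∈ I, 0 < lam i ∧ lam i < 1) ∧ latt x = ∑ i ∈ I, lam i • vhat v i} with hS
  have hunion : {x : Fin (n + 1) → ℤ | ∃ lam : Fin (n + 1) → ℝ,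
      (∀ i ∈ J, 0 ≤ lam i ∧ lam i < 1) ∧ latt x = ∑ i ∈ J, lam i • vhat v i} =
      ⋃ I ∈ (J.powerset : Set (Finset (Fin (n + 1)))), S I := by
    ext x
    simp only [Set.mem_ofPred_eq, Set.mem_iUnion, Finset.mem_coe, Finset.mem_powerset, hS,
      exists_prop]
    constructor
    · rintro ⟨lam, h1, h2⟩
      refine ⟨J.filter fun i => lam i ≠ 0, Finset.filter_subset _ _, lam, fun i hi => ?_, ?_⟩
      · rw [Finset.mem_filter] at hi
        exact ⟨lt_of_le_of_ne (h1 i hi.1).1 hi.2.symm, (h1 i hi.1).2⟩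
      · rw [h2, Finset.sum_filter_of_ne]
        intro i _ hi h
        exact hi (by simp [h])
    · rintro ⟨I, hI, lam, h1, h2⟩
      refine ⟨fun i => if i ∈ I then lam i else 0, fun i _ => ?_, ?_⟩
      · by_cases h : i ∈ I
        · simpa [h] using ⟨(h1 i h).1.le, (h1 i h).2⟩
        · simp [h]
      · simp [ite_smul, Finset.sum_ite_mem, Finset.inter_eq_right.2 hI, h2]
  rw [hunion] at hfin ⊢
  rw [(Finset.finite_toSet _).ncard_biUnion, finsum_mem_coe_finset]
  · rfl
  · intro I hI
    exact hfin.subset (Set.subset_biUnion_of_mem hI)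
  · intro I _ I' _ hne
    rw [Function.onFun, Set.disjoint_left]
    rintro x ⟨lam, h1, h2⟩ ⟨lam', h1', h2'⟩
    apply hne
    have key := Fintype.linearIndependent_iff.1 (linearIndependent_vhat v hv)
      (fun i => (if i ∈ I then lam i else 0) - (if i ∈ I' then lam' i else 0))
      (by simp [sub_smul, ite_smul, Finset.sum_sub_distrib, Finset.sum_ite_mem, ← h2, ← h2'])
    ext i
    have := key i
    by_cases hi : i ∈ I <;> by_cases hi' : i ∈ I' <;> simp [hi, hi'] at this ⊢
    · exact (h1 i hi).1.ne' this
    · exact (h1' i hi').1.ne' this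

/-- The faces of a simplex are the convex hulls of nonempty sets of vertices. -/
lemma isFaceOfDim_iff {n : ℕ} {p : Fin (n + 1) → Fin n → ℝ} (hp : AffineIndependent ℝ p)
    (F : Set (Fin n → ℝ)) (j : ℕ) :
    IsFaceOfDim (convexHull ℝ (Set.range p)) F j ↔
      ∃ J : Finset (Fin (n + 1)), J.card = j + 1 ∧ convexHull ℝ (p '' J) = F := by
  have hdim (J : Finset (Fin (n + 1))) (k : ℕ) (hJ : J.card = k + 1) :
      Module.finrank ℝ (affineSpan ℝ (convexHull ℝ (p '' J))).direction = k := by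
    classical
    rw [affineSpan_convexHull, direction_affineSpan, ← Finset.coe_image]
    exact hp.finrank_vectorSpan_image_finset hJ
  constructor
  · rintro ⟨hne, hexp, hF⟩
    classical
    have hcpt : IsCompact F := hexp.isCompact ((Set.finite_range p).isCompact_convexHull ℝ)
    have hconv : Convex ℝ F := hexp.convex (convex_convexHull ℝ _)
    set J : Finset (Fin (n + 1)) := Finset.univ.filter fun i => p i ∈ F with hJ
    have hJF : convexHull ℝ (p '' J) = F := by
      apply le_antisymm
      · refine convexHull_min ?_ hconv
        rintro _ ⟨i, hi, rfl⟩
        simpa [hJ] using hi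
      · rw [← closure_convexHull_extremePoints hcpt hconv]
        refine closure_minimal (convexHull_mono ?_)
          ((J.finite_toSet.image p).isCompact_convexHull ℝ).isClosed
        intro x hx
        obtain ⟨i, rfl⟩ := extremePoints_convexHull_subset
          (hexp.isExtreme.extremePoints_subset_extremePoints hx)
        exact ⟨i, by simpa [hJ] using hx.1, rfl⟩
    refine ⟨J, ?_, hJF⟩
    have hpos : 0 < J.card := by
      rw [Finset.card_pos, Finset.nonempty_iff_ne_empty]
      intro h
      rw [← hJF, h] at hne
      simp at hne
    have := hdim J (J.card - 1) (by omega)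
    rw [hJF, hF] at this
    omega
  · rintro ⟨J, hJ, rfl⟩
    refine ⟨?_, ?_, hdim J j hJ⟩
    · rw [convexHull_nonempty_iff, Set.image_nonempty, Finset.coe_nonempty, ← Finset.card_pos]
      omega
    · intro _
      let b : AffineBasis (Fin (n + 1)) ℝ (Fin n → ℝ) :=
        ⟨p, hp, by rw [hp.affineSpan_eq_top_iff_card_eq_finrank_add_one]; simp⟩
      have hb (i) : b i = p i := rfl
      have hbr : Set.range p = Set.range b := rfl
      let g : (Fin n → ℝ) →ᵃ[ℝ] ℝ := ∑ i ∈ J, b.coord i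
      have hg (x) : g x = ∑ i ∈ J, b.coord i x := by
        have (s : Finset (Fin (n + 1))) : (∑ i ∈ s, b.coord i) x = ∑ i ∈ s, b.coord i x := by
          induction s using Finset.induction_on <;> simp_all [Finset.sum_insert]
        exact this J
      have hglin (x) : g.linear x = g x - g 0 := by
        simpa [eq_sub_iff_add_eq] using (g.map_vadd 0 x).symm
      have hsum (x) : ∑ i ∈ J, b.coord i x + ∑ i ∈ Jᶜ, b.coord i x = 1 := by
        rw [Finset.sum_add_sum_compl, b.sum_coord_apply_eq_one]
      have hJne : J.Nonempty := by rw [← Finset.card_pos]; omega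
      obtain ⟨i₀, hi₀⟩ := hJne
      refine ⟨LinearMap.toContinuousLinearMap g.linear, ?_⟩
      apply Set.Subset.antisymm
      · refine convexHull_min ?_ ?_
        · rintro _ ⟨i, hi, rfl⟩
          refine ⟨subset_convexHull _ _ ⟨i, rfl⟩, fun y hy => ?_⟩
          rw [hbr, b.convexHull_eq_nonneg_coord] at hy
          have h1 : ∑ k ∈ J, b.coord k (p i) = 1 := by
            rw [← hb]
            simp [AffineBasis.coord_apply, Finset.mem_coe.1 hi]
          have h2 := hsum y
          have h3 : 0 ≤ ∑ i ∈ Jᶜ, b.coord i y := Finset.sum_nonneg fun k _ => hy k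
          simp only [LinearMap.coe_toContinuousLinearMap', hglin, hg, h1]
          linarith
        · have hexp : IsExposed ℝ (convexHull ℝ (Set.range p))
              {x ∈ convexHull ℝ (Set.range p) | ∀ y ∈ convexHull ℝ (Set.range p),
                LinearMap.toContinuousLinearMap g.linear y ≤
                  LinearMap.toContinuousLinearMap g.linear x} := fun _ => ⟨_, rfl⟩
          exact hexp.convex (convex_convexHull ℝ _)
      · rintro x ⟨hx, hmax⟩
        have h1 := hmax (p i₀) (subset_convexHull _ _ ⟨i₀, rfl⟩)
        rw [hbr, b.convexHull_eq_nonneg_coord] at hx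
        have h2 : ∑ k ∈ J, b.coord k (p i₀) = 1 := by
          rw [← hb]
          simp [AffineBasis.coord_apply, hi₀]
        simp only [LinearMap.coe_toContinuousLinearMap', hglin, hg, h2] at h1
        have h3 : 0 ≤ ∑ i ∈ Jᶜ, b.coord i x := Finset.sum_nonneg fun k _ => hx k
        have h4 := hsum x
        have h5 : ∑ i ∈ Jᶜ, b.coord i x = 0 := by linarith
        have h6 := (Finset.sum_eq_zero_iff_of_nonneg fun k _ => hx k).1 h5
        have h7 : x = ∑ i ∈ J, b.coord i x • p i := by
          conv_lhs => rw [← b.linear_combination_coord_eq_self x]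
          rw [← Finset.sum_add_sum_compl J, Finset.sum_eq_zero (s := Jᶜ), add_zero]
          · rfl
          · intro k hk
            rw [h6 k hk, zero_smul]
        rw [h7]
        refine (convex_convexHull ℝ _).sum_mem (fun k _ => hx k) (by linarith) fun k hk => ?_
        exact subset_convexHull _ _ ⟨k, hk, rfl⟩

lemma convexHull_image_injective {n : ℕ} {p : Fin (n + 1) → Fin n → ℝ}
    (hp : AffineIndependent ℝ p) :
    Function.Injective fun J : Finset (Fin (n + 1)) => convexHull ℝ (p '' J) := by
  have key (J J' : Finset (Fin (n + 1)))
      (h : convexHull ℝ (p '' J) = convexHull ℝ (p '' J')) : J ⊆ J' := by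
    intro i hi
    have : p i ∈ convexHull ℝ (p '' J') := h ▸ subset_convexHull _ _ ⟨i, hi, rfl⟩
    exact (hp.mem_affineSpan_iff i J').1 (convexHull_subset_affineSpan _ this)
  exact fun J J' h => (key J J' h).antisymm (key J' J h.symm)

lemma sum_powerset_neg_one_pow_card_mul_sub {α : Type*} [DecidableEq α] (s : Finset α) (c : ℝ) :
    ∑ K ∈ s.powerset, (-1 : ℝ) ^ K.card * (c - K.card) =
      if s.card = 0 then c else if s.card = 1 then 1 else 0 := by
  have hzero (t : Finset α) :
      ∑ K ∈ t.powerset, (-1 : ℝ) ^ K.card = if t.card = 0 then 1 else 0 := by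
    have := congrArg (Int.cast : ℤ → ℝ) (Finset.sum_powerset_neg_one_pow_card (x := t))
    simpa using this
  induction s using Finset.induction_on with
  | empty => simp
  | insert a t ha _ =>
    rw [Finset.sum_powerset_insert ha, ← Finset.sum_add_distrib, Finset.card_insert_of_notMem ha,
      Finset.sum_congr rfl (g := fun K => (-1 : ℝ) ^ K.card), hzero]
    · simp
    · intro K hK
      rw [Finset.card_insert_of_notMem fun h => ha (Finset.mem_powerset.1 hK h)]
      push_cast
      ring

lemma sum_superset_neg_one_pow_mul_card {n : ℕ} (I : Finset (Fin (n + 1))) :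
    ∑ J ∈ Finset.univ.filter (fun J => I ⊆ J), (-1 : ℝ) ^ (n + 1 - J.card) * J.card =
      I.card.choose n := by
  have h : ∑ J ∈ Finset.univ.filter (fun J => I ⊆ J), (-1 : ℝ) ^ (n + 1 - J.card) * J.card =
      ∑ K ∈ Iᶜ.powerset, (-1 : ℝ) ^ K.card * ((n + 1 : ℝ) - K.card) := by
    refine Finset.sum_nbij' compl compl ?_ ?_ ?_ ?_ ?_
    · intro J hJ
      simpa using hJ
    · intro K hK
      have := Finset.mem_powerset.1 hK
      simpa using Finset.subset_compl_comm.1 this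
    · simp
    · simp
    · intro J _
      have : J.card ≤ n + 1 := by simpa using J.card_le_univ
      rw [Finset.card_compl, Fintype.card_fin, Nat.cast_sub this]
      push_cast
      ring
  rw [h, sum_powerset_neg_one_pow_card_mul_sub, Finset.card_compl, Fintype.card_fin]
  have hI : I.card ≤ n + 1 := by simpa using I.card_le_univ
  by_cases h1 : I.card = n + 1
  · simp [h1]
  · by_cases h2 : I.card = n
    · simp [h2]
    · rw [if_neg (by omega), if_neg (by omega), Nat.choose_eq_zero_of_lt (by omega), Nat.cast_zero]

/-- The normalized volume of a face is the sum of the `s_I` over the sets `I` of its vertices. -/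
lemma volZ_face_eq_sum_sI {n : ℕ} (v : Fin (n + 1) → Fin n → ℤ)
    (hind : AffineIndependent ℝ fun i => latt (v i)) (J : Finset (Fin (n + 1))) (j : ℕ)
    (hJ : J.card = j + 1) (V : ℝ)
    (hV : ∀ φ : (Fin j → ℝ) →ᵃ[ℝ] (Fin n → ℝ),
      IsUnimodularParam (convexHull ℝ ((fun i => latt (v i)) '' J)) φ →
        V = (j.factorial : ℝ) *
          (volume (φ ⁻¹' convexHull ℝ ((fun i => latt (v i)) '' J))).toReal) :
    V = ∑ I ∈ J.powerset, (sI v I : ℝ) := by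
  let σ : Fin (j + 1) ≃ J := (J.equivFinOfCardEq hJ).symm
  let u : Fin (j + 1) → Fin n → ℤ := fun k => v (σ k)
  have hu : AffineIndependent ℝ fun k => latt (u k) :=
    hind.comp_embedding (σ.toEmbedding.trans (Function.Embedding.subtype _))
  have hrange : (fun i => latt (v i)) '' J = Set.range fun k => latt (u k) := by
    ext x
    constructor
    · rintro ⟨i, hi, rfl⟩
      exact ⟨σ.symm ⟨i, hi⟩, by simp [u]⟩
    · rintro ⟨k, rfl⟩
      exact ⟨σ k, (σ k).2, rfl⟩
  have hsum (lam : Fin (n + 1) → ℝ) : ∑ i ∈ J, lam i • vhat v i =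
      ∑ k, lam (σ k) • (Fin.snoc (latt (u k)) 1 : Fin (n + 1) → ℝ) := by
    rw [← Finset.sum_coe_sort J, ← Equiv.sum_comp σ]
    rfl
  have hset : {x : Fin (n + 1) → ℤ | ∃ lam : Fin (n + 1) → ℝ,
        (∀ i ∈ J, 0 ≤ lam i ∧ lam i < 1) ∧ latt x = ∑ i ∈ J, lam i • vhat v i} =
      {x : Fin (n + 1) → ℤ | ∃ lam : Fin (j + 1) → ℝ, (∀ i, 0 ≤ lam i ∧ lam i < 1) ∧
        latt x = ∑ i, lam i • (Fin.snoc (latt (u i)) 1 : Fin (n + 1) → ℝ)} := by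
    ext x
    constructor
    · rintro ⟨lam, h1, h2⟩
      exact ⟨fun k => lam (σ k), fun k => h1 _ (σ k).2, by rw [h2, hsum]⟩
    · rintro ⟨lam, h1, h2⟩
      refine ⟨fun i => if h : i ∈ J then lam (σ.symm ⟨i, h⟩) else 0, fun i hi => ?_, ?_⟩
      · simpa [hi] using h1 _
      · rw [h2, hsum]
        simp
  obtain ⟨φ, hφ, h0⟩ := exists_isUnimodularParam u hu
  obtain ⟨h1, h2⟩ := factorial_mul_volume_eq_ncard u hu φ hφ h0
  rw [hV φ (hrange ▸ hφ), hrange, h1, ← Nat.cast_sum, ← sum_powerset_sI v hind J, hset]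
  rw [hset]
  exact Set.finite_of_ncard_pos h2

/-- For an `n`-dimensional lattice simplex `P ⊂ ℝ^n` with vertices
`v_0, …, v_n`, one has
`c(P) = ∑_{j=0}^n (-1)^{n-j} (j+1) ∑_{F ∈ F(P)_j} Vol_ℤ(F)
      = ∑_{I ⊆ {0,…,n}} C(|I|, n) · s_I`. -/
theorem simplex_c_formula {n : ℕ} (v : Fin (n + 1) → Fin n → ℤ)
    (hind : AffineIndependent ℝ (fun i => latt (v i)))
    (P : Set (Fin n → ℝ)) (hP : P = convexHull ℝ (Set.range (fun i => latt (v i))))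
    (hfull : affineSpan ℝ P = ⊤)
    (VolZ : ℕ → Set (Fin n → ℝ) → ℝ)
    (hVolZ : ∀ (j : ℕ) (F : Set (Fin n → ℝ)), IsFaceOfDim P F j →
      ∀ φ : (Fin j → ℝ) →ᵃ[ℝ] (Fin n → ℝ), IsUnimodularParam F φ →
        VolZ j F = (Nat.factorial j : ℝ) * (volume (φ ⁻¹' F)).toReal) :
    ∑ j ∈ Finset.range (n + 1),
        (-1 : ℝ) ^ (n - j) * (j + 1) * ∑ᶠ F ∈ {F | IsFaceOfDim P F j}, VolZ j F
      = ∑ I ∈ (Finset.univ : Finset (Fin (n + 1))).powerset,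
          (I.card.choose n : ℝ) * (sI v I : ℝ) := by
  subst hP
  have hVJ (j : ℕ) (J : Finset (Fin (n + 1))) (hJ : J.card = j + 1) :
      VolZ j (convexHull ℝ ((fun i => latt (v i)) '' J)) = ∑ I ∈ J.powerset, (sI v I : ℝ) :=
    volZ_face_eq_sum_sI v hind J j hJ _ fun φ hφ =>
      hVolZ j _ ((isFaceOfDim_iff hind _ j).2 ⟨J, hJ, rfl⟩) φ hφ
  have hfaces (j : ℕ) :
      ∑ᶠ F ∈ {F | IsFaceOfDim (convexHull ℝ (Set.range fun i => latt (v i))) F j}, VolZ j F =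
        ∑ J ∈ Finset.univ.powersetCard (j + 1), ∑ I ∈ J.powerset, (sI v I : ℝ) := by
    have : {F | IsFaceOfDim (convexHull ℝ (Set.range fun i => latt (v i))) F j} =
        (fun J : Finset (Fin (n + 1)) => convexHull ℝ ((fun i => latt (v i)) '' J)) ''
          (Finset.univ.powersetCard (j + 1) : Finset (Finset (Fin (n + 1)))) := by
      ext F
      simp [isFaceOfDim_iff hind]
    rw [this, finsum_mem_image (convexHull_image_injective hind).injOn, finsum_mem_coe_finset]
    exact Finset.sum_congr rfl fun J hJ => hVJ j J (Finset.mem_powersetCard.1 hJ).2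
  have hleft : ∑ j ∈ Finset.range (n + 1), (-1 : ℝ) ^ (n - j) * (j + 1) *
        ∑ᶠ F ∈ {F | IsFaceOfDim (convexHull ℝ (Set.range fun i => latt (v i))) F j}, VolZ j F =
      ∑ J : Finset (Fin (n + 1)), (-1 : ℝ) ^ (n + 1 - J.card) * J.card *
        ∑ I ∈ J.powerset, (sI v I : ℝ) := by
    rw [← Finset.powerset_univ, Finset.sum_powerset, Finset.card_univ, Fintype.card_fin,
      Finset.sum_range_succ' _ (n + 1)]
    simp only [Finset.powersetCard_zero, Finset.sum_singleton, Finset.card_empty, Nat.cast_zero,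
      mul_zero, zero_mul, add_zero]
    refine Finset.sum_congr rfl fun j _ => ?_
    rw [hfaces, Finset.mul_sum]
    refine Finset.sum_congr rfl fun J hJ => ?_
    rw [(Finset.mem_powersetCard.1 hJ).2, Nat.add_sub_add_right]
    push_cast
    rfl
  rw [hleft, Finset.powerset_univ]
  simp_rw [← sum_superset_neg_one_pow_mul_card, Finset.mul_sum, Finset.sum_mul]
  exact Finset.sum_comm' (by simp)
end
end

section
/- For all integers n ≥ 1 and s with 0 ≤ s ≤ n + 1, one has Σ_{j=0}^{n} (−1)^j (j+1) · C(n+1−s, n−j) = (−1)^n · C(s, n). -/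
/-- The alternating first moment of row `m + 1` of Pascal's triangle. -/
theorem alternating_sum_range_mul_choose (m : ℕ) :
    ∑ k ∈ Finset.range (m + 2), (-1 : ℤ) ^ k * (k : ℤ) * ((m + 1).choose k)
      = if m = 0 then -1 else 0 := by
  have absorb : ∀ k ∈ Finset.range (m + 1),
      (-1 : ℤ) ^ (k + 1) * ((k + 1 : ℕ) : ℤ) * ((m + 1).choose (k + 1))
        = -((m : ℤ) + 1) * ((-1 : ℤ) ^ k * (m.choose k)) := by
    intro k _
    have h : ((m : ℤ) + 1) * (m.choose k) = ((m + 1).choose (k + 1)) * ((k : ℤ) + 1) := by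
      exact_mod_cast Nat.add_one_mul_choose_eq m k
    push_cast
    linear_combination (-1 : ℤ) ^ k * h
  rw [Finset.sum_range_succ', Finset.sum_congr rfl absorb, ← Finset.mul_sum,
    Int.alternating_sum_range_choose]
  split_ifs with h <;> simp [h]

/-- The alternating sum of row `m` of Pascal's triangle, weighted by `a - k`. -/
theorem alternating_sum_range_sub_mul_choose (a : ℤ) (m : ℕ) :
    ∑ k ∈ Finset.range (m + 1), (-1 : ℤ) ^ k * (a - k) * (m.choose k)
      = if m = 0 then a else if m = 1 then 1 else 0 := by
  cases m with
  | zero => simp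
  | succ m =>
    have split : ∀ k ∈ Finset.range (m + 1 + 1),
        (-1 : ℤ) ^ k * (a - k) * ((m + 1).choose k)
          = a * ((-1 : ℤ) ^ k * ((m + 1).choose k))
            - (-1 : ℤ) ^ k * (k : ℤ) * ((m + 1).choose k) := fun k _ => by ring
    rw [Finset.sum_congr rfl split, Finset.sum_sub_distrib, ← Finset.mul_sum,
      Int.alternating_sum_range_choose, alternating_sum_range_mul_choose]
    by_cases h : m = 0 <;> simp [h]

/-- For all integers `n ≥ 1` and `0 ≤ s ≤ n + 1`,
`∑_{j=0}^{n} (-1)^j (j+1) · C(n+1-s, n-j) = (-1)^n · C(s, n)`. -/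
theorem alternating_binomial_sum (n s : ℕ) (hn : 1 ≤ n) (hs : s ≤ n + 1) :
    ∑ j ∈ Finset.range (n + 1),
        (-1 : ℤ) ^ j * ((j : ℤ) + 1) * ((n + 1 - s).choose (n - j))
      = (-1 : ℤ) ^ n * (s.choose n) := by
  obtain ⟨m, hm⟩ : ∃ m, m = n + 1 - s := ⟨_, rfl⟩
  rw [← hm, ← Finset.sum_range_reflect]
  have reflect : ∀ k ∈ Finset.range (n + 1),
      (-1 : ℤ) ^ (n + 1 - 1 - k) * (((n + 1 - 1 - k : ℕ) : ℤ) + 1)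
          * (m.choose (n - (n + 1 - 1 - k)))
        = (-1 : ℤ) ^ n * ((-1 : ℤ) ^ k * (((n : ℤ) + 1) - k) * (m.choose k)) := by
    intro k hk
    obtain ⟨d, rfl⟩ := Nat.exists_eq_add_of_le (Nat.lt_succ_iff.mp (Finset.mem_range.mp hk))
    have h1 : k + d + 1 - 1 - k = d := by omega
    have h2 : k + d - d = k := by omega
    have h3 : (-1 : ℤ) ^ k * (-1) ^ k = 1 := by rw [← mul_pow]; simp
    rw [h1, h2, pow_add]
    push_cast
    linear_combination (-(-1 : ℤ) ^ d * ((d : ℤ) + 1) * (m.choose k)) * h3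
  rw [Finset.sum_congr rfl reflect, ← Finset.mul_sum]
  congr 1
  have extend : ∑ k ∈ Finset.range (n + 1), (-1 : ℤ) ^ k * (((n : ℤ) + 1) - k) * (m.choose k)
      = ∑ k ∈ Finset.range (n + 2), (-1 : ℤ) ^ k * (((n : ℤ) + 1) - k) * (m.choose k) := by
    rw [Finset.sum_range_succ _ (n + 1)]
    simp
  have restrict : ∑ k ∈ Finset.range (m + 1), (-1 : ℤ) ^ k * (((n : ℤ) + 1) - k) * (m.choose k)
      = ∑ k ∈ Finset.range (n + 2), (-1 : ℤ) ^ k * (((n : ℤ) + 1) - k) * (m.choose k) := by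
    refine Finset.sum_subset (Finset.range_subset_range.mpr (by omega)) fun k _ hk => ?_
    rw [Finset.mem_range] at hk
    rw [Nat.choose_eq_zero_of_lt (by omega : m < k)]
    simp
  rw [extend, ← restrict, alternating_sum_range_sub_mul_choose]
  split_ifs with h0 h1
  · obtain rfl : s = n + 1 := by omega
    simp
  · obtain rfl : s = n := by omega
    simp
  · rw [Nat.choose_eq_zero_of_lt (by omega)]
    simp
end
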